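/- Let q be a power of an odd prime and let A = 𝔽_q[T]. Let α = [[a, b], [c, d]] ∈ SL₂(A) and let r be a positive integer. Then there exist t⁽¹⁾, …, t⁽¹⁰⁾ ∈ A, a nonzero ε ∈ 𝔽_q, β ∈ M_Λ, and γ ∈ M_Λᵀ such that the matrix α^r · t⁽¹⁾_{12} · t⁽²⁾_{21} · t⁽³⁾_{12} · β · t⁽⁴⁾_{12} · t⁽⁵⁾_{21} · t⁽⁶⁾_{12} · t⁽⁷⁾_{21} · γ · t⁽⁸⁾_{21} · t⁽⁹⁾_{12} · t⁽¹⁰⁾_{21} has first row equal to (a^r, εb). -/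

import Mathlib

open Polynomial Matrix

/-- The elementary matrix `m_{12} = [[1, m], [0, 1]]`. -/
def m₁₂ {R : Type*} [CommRing R] (m : R) : Matrix (Fin 2) (Fin 2) R := !![1, m; 0, 1]

/-- The elementary matrix `m_{21} = [[1, 0], [m, 1]]`. -/
def m₂₁ {R : Type*} [CommRing R] (m : R) : Matrix (Fin 2) (Fin 2) R := !![1, 0; m, 1]

/-- The set `M_Λ` of products `[[1+ae, be²], [c, 1+de]] · [[1+ae, ce²], [b, 1+de]]`
with `a, b, c, d, e ∈ R` such that the first factor has determinant `1`. -/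
def MLambda (R : Type*) [CommRing R] : Set (Matrix (Fin 2) (Fin 2) R) :=
  {x | ∃ a b c d e : R,
    (!![1 + a * e, b * e ^ 2; c, 1 + d * e] : Matrix (Fin 2) (Fin 2) R).det = 1 ∧
    x = !![1 + a * e, b * e ^ 2; c, 1 + d * e] * !![1 + a * e, c * e ^ 2; b, 1 + d * e]}

/-- `M_Λᵀ`: the set of transposes of elements of `M_Λ`. -/
def MLambdaT (R : Type*) [CommRing R] : Set (Matrix (Fin 2) (Fin 2) R) :=
  {x | ∃ y ∈ MLambda R, x = yᵀ}

/-- Over a finite field of odd order, the form `u² - z w²` with `z ≠ 0` represents everything. -/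
theorem FiniteField.exists_sq_sub_mul_sq_eq {K : Type*} [Field K] [Finite K]
    (h2 : (2 : K) ≠ 0) {z : K} (hz : z ≠ 0) (v : K) : ∃ u w : K, u ^ 2 - z * w ^ 2 = v := by
  have := Fintype.ofFinite K
  have hcard : Fintype.card K % 2 = 1 := by
    refine FiniteField.odd_card_of_char_ne_two fun h => h2 ?_
    have := ringChar.Nat.cast_ringChar (R := K)
    rw [h] at this
    exact_mod_cast this
  obtain ⟨u, w, h⟩ := FiniteField.exists_root_sum_quadratic
    (f := X ^ 2 - C v) (g := C (-z) * X ^ 2)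
    (degree_X_pow_sub_C two_pos v) (degree_C_mul_X_pow 2 (neg_ne_zero.2 hz)) hcard
  refine ⟨u, w, ?_⟩
  simp only [eval_sub, eval_mul, eval_pow, eval_X, eval_C] at h
  linear_combination h

/-- In a principal ideal domain, if no prime divides all of `u`, `x`, `w`, then the class of `u`
modulo `x` contains an element coprime to `w`. -/
theorem exists_isCoprime_add_mul {R : Type*} [CommRing R] [IsDomain R] [IsPrincipalIdealRing R]
    {w : R} (hw : w ≠ 0) (u x : R)
    (h : ∀ p, Prime p → p ∣ u → p ∣ x → ¬ p ∣ w) : ∃ k, IsCoprime (u + k * x) w := by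
  induction w using UniqueFactorizationMonoid.induction_on_prime with
  | h₁ => exact absurd rfl hw
  | h₂ w hu =>
    obtain ⟨i, hi⟩ := hu.exists_left_inv
    exact ⟨0, 0, i, by simpa using hi⟩
  | h₃ y p hy hp ih =>
    obtain ⟨k, hk⟩ := ih hy fun l hl hlu hlx hly => h l hl hlu hlx (hly.mul_left p)
    by_cases hpu : p ∣ u + k * x
    · have hpx : ¬ p ∣ x := fun hpx =>
        h p hp ((dvd_add_left (hpx.mul_left k)).1 hpu) hpx (dvd_mul_right p y)
      have hpy : ¬ p ∣ y := fun hpy => hp.not_isUnit (hk.isUnit_of_dvd' hpu hpy)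
      refine ⟨k + y, IsCoprime.mul_right ?_ ?_⟩
      · refine ((hp.coprime_iff_not_dvd).2 fun hd => ?_).symm
        have : p ∣ y * x := by
          have := dvd_sub hd hpu
          rwa [show u + (k + y) * x - (u + k * x) = y * x by ring] at this
        exact (hp.dvd_or_dvd this).elim hpy hpx
      · rw [show u + (k + y) * x = u + k * x + y * x by ring]
        exact hk.add_mul_left_left x
    · exact ⟨k, IsCoprime.mul_right ((hp.coprime_iff_not_dvd).2 hpu).symm hk⟩

section QuadraticForm

variable {F : Type*} [Field F] [Finite F]

/-- The form `u² - z w²` represents everything modulo an irreducible polynomial prime to `z`. -/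
theorem Polynomial.exists_dvd_sq_sub_mul_sq_sub_of_irreducible (h2 : (2 : F) ≠ 0) {p : F[X]}
    (hp : Irreducible p) {z : F[X]} (hz : ¬ p ∣ z) (v : F[X]) :
    ∃ u w : F[X], p ∣ u ^ 2 - z * w ^ 2 - v := by
  have := Fact.mk hp
  have : Module.Finite F (AdjoinRoot p) := (AdjoinRoot.powerBasis hp.ne_zero).finite
  have : Finite (AdjoinRoot p) := Module.finite_of_finite F
  have h2' : (2 : AdjoinRoot p) ≠ 0 := by
    rw [← map_ofNat (AdjoinRoot.of p) 2]
    exact (_root_.map_ne_zero _).2 h2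
  have hz' : AdjoinRoot.mk p z ≠ 0 := fun h => hz (AdjoinRoot.mk_eq_zero.1 h)
  obtain ⟨u, w, h⟩ := FiniteField.exists_sq_sub_mul_sq_eq h2' hz' (AdjoinRoot.mk p v)
  obtain ⟨u, rfl⟩ := AdjoinRoot.mk_surjective u
  obtain ⟨w, rfl⟩ := AdjoinRoot.mk_surjective w
  refine ⟨u, w, AdjoinRoot.mk_eq_zero.1 ?_⟩
  simp [h]

/-- The form `u² - z w²` represents every unit modulo a nonzero polynomial prime to `z`. -/
theorem Polynomial.exists_dvd_sq_sub_mul_sq_sub (h2 : (2 : F) ≠ 0) {x : F[X]} (hx : x ≠ 0)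
    {z v : F[X]} (hz : IsCoprime x z) (hv : IsCoprime x v) :
    ∃ u w : F[X], x ∣ u ^ 2 - z * w ^ 2 - v := by
  induction x using UniqueFactorizationMonoid.induction_on_prime with
  | h₁ => exact absurd rfl hx
  | h₂ x hu => exact ⟨0, 0, hu.dvd⟩
  | h₃ y p hy hp ih =>
    obtain ⟨u, w, h, hh⟩ := ih hy hz.of_mul_left_right hv.of_mul_left_right
    have hpz : ¬ p ∣ z := (hp.coprime_iff_not_dvd).1 hz.of_mul_left_left
    have hpv : ¬ p ∣ v := (hp.coprime_iff_not_dvd).1 hv.of_mul_left_left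
    have hp2 : ¬ p ∣ 2 := fun hd => hp.not_isUnit <| isUnit_of_dvd_unit hd <| by
      rw [← map_ofNat (C : F →+* F[X]) 2]
      exact isUnit_C.2 h2.isUnit
    by_cases hpy : p ∣ y
    · -- A Newton step lifts a solution modulo `y` to one modulo `p * y`.
      suffices ∃ s t : F[X], p ∣ h + 2 * u * s - 2 * z * w * t by
        obtain ⟨s, t, hst⟩ := this
        refine ⟨u + y * s, w + y * t, ?_⟩
        rw [show (u + y * s) ^ 2 - z * (w + y * t) ^ 2 - v =
          (h + 2 * u * s - 2 * z * w * t + y * (s ^ 2 - z * t ^ 2)) * y by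
            linear_combination hh]
        exact mul_dvd_mul_right (dvd_add hst (hpy.mul_right _)) y
      by_cases hpu : p ∣ u
      · have hpw : ¬ p ∣ w := fun hpw => hpv <| by
          have h1 : p ∣ u ^ 2 - z * w ^ 2 - v := hh ▸ hpy.mul_right h
          have h3 : p ∣ u ^ 2 - z * w ^ 2 :=
            dvd_sub (dvd_pow hpu two_ne_zero) ((dvd_pow hpw two_ne_zero).mul_left z)
          simpa using dvd_sub h3 h1
        have hc : IsCoprime p (2 * z * w) :=
          (hp.coprime_iff_not_dvd).2 (hp.not_dvd_mul (hp.not_dvd_mul hp2 hpz) hpw)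
        obtain ⟨i, j, hij⟩ := hc
        refine ⟨0, j * h, i * h, ?_⟩
        linear_combination -h * hij
      · have hc : IsCoprime p (2 * u) := (hp.coprime_iff_not_dvd).2 (hp.not_dvd_mul hp2 hpu)
        obtain ⟨i, j, hij⟩ := hc
        refine ⟨-j * h, 0, i * h, ?_⟩
        linear_combination -h * hij
    · obtain ⟨u₁, w₁, h₁, hh₁⟩ :=
        exists_dvd_sq_sub_mul_sq_sub_of_irreducible h2 hp.irreducible hpz v
      have hc : IsCoprime p y := (hp.coprime_iff_not_dvd).2 hpy
      obtain ⟨i, j, hij⟩ := id hc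
      refine ⟨u + j * y * (u₁ - u), w + j * y * (w₁ - w), hc.mul_dvd ?_ ?_⟩
      · have e (s s₁ : F[X]) : s + j * y * (s₁ - s) = s₁ - p * (i * (s₁ - s)) := by
          linear_combination (s₁ - s) * hij
        rw [e, e]
        generalize i * (u₁ - u) = k
        generalize i * (w₁ - w) = l
        refine ⟨h₁ - 2 * u₁ * k + p * k ^ 2 - z * (- 2 * w₁ * l + p * l ^ 2), ?_⟩
        linear_combination hh₁
      · rw [show j * y * (u₁ - u) = y * (j * (u₁ - u)) by ring,
          show j * y * (w₁ - w) = y * (j * (w₁ - w)) by ring]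
        generalize j * (u₁ - u) = k
        generalize j * (w₁ - w) = l
        refine ⟨h + 2 * u * k + y * k ^ 2 - z * (2 * w * l + y * l ^ 2), ?_⟩
        linear_combination hh

/-- For `z` and `v` prime to `x`, the class of `v` modulo `x` contains a properly represented
value of the form `u² - z w²`. -/
theorem Polynomial.exists_isCoprime_sq_sub_mul_sq_eq (h2 : (2 : F) ≠ 0) {x z v : F[X]}
    (hz : IsCoprime x z) (hv : IsCoprime x v) :
    ∃ u w k : F[X], IsCoprime u w ∧ u ^ 2 - z * w ^ 2 = v + k * x := by
  rcases eq_or_ne x 0 with rfl | hx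
  · obtain ⟨z₀, hz₀, rfl⟩ := Polynomial.isUnit_iff.1 (isCoprime_zero_left.1 hz)
    obtain ⟨v₀, hv₀, rfl⟩ := Polynomial.isUnit_iff.1 (isCoprime_zero_left.1 hv)
    have hz₁ : z₀ ≠ 0 := hz₀.ne_zero
    obtain ⟨u, w, h⟩ := FiniteField.exists_sq_sub_mul_sq_eq h2 hz₁ v₀
    have hC : (C u ^ 2 - C z₀ * C w ^ 2 : F[X]) = C v₀ := by
      rw [← h, C_sub, C_mul, C_pow, C_pow]
    obtain ⟨v', hv'⟩ := (isUnit_C.2 hv₀).exists_left_inv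
    refine ⟨C u, C w, 0, ⟨v' * C u, -v' * C z₀ * C w, ?_⟩, by simpa using hC⟩
    linear_combination v' * hC + hv'
  · obtain ⟨u, w₀, h₀⟩ := exists_dvd_sq_sub_mul_sq_sub h2 hx hz hv
    obtain ⟨w, hw, h⟩ : ∃ w ≠ 0, x ∣ u ^ 2 - z * w ^ 2 - v := by
      rcases eq_or_ne w₀ 0 with rfl | hw
      · refine ⟨x, hx, ?_⟩
        rw [show u ^ 2 - z * x ^ 2 - v = u ^ 2 - z * 0 ^ 2 - v - x * (z * x) by ring]
        exact dvd_sub h₀ (dvd_mul_right _ _)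
      · exact ⟨w₀, hw, h₀⟩
    obtain ⟨k, hk⟩ := exists_isCoprime_add_mul hw u x fun p hp hpu hpx hpw => by
      refine hp.not_isUnit (hv.isUnit_of_dvd' hpx ?_)
      have h3 : p ∣ u ^ 2 - z * w ^ 2 :=
        dvd_sub (dvd_pow hpu two_ne_zero) ((dvd_pow hpw two_ne_zero).mul_left z)
      simpa using dvd_sub h3 (hpx.trans h)
    obtain ⟨l, hl⟩ := h
    refine ⟨u + k * x, w, l + 2 * u * k + k ^ 2 * x, hk, ?_⟩
    linear_combination hl

/-- For `z` and `v` prime to `x`, the class of `v` modulo `x` contains an element modulo which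
`z` is a square. -/
theorem Polynomial.exists_dvd_sq_sub (h2 : (2 : F) ≠ 0) {x z v : F[X]}
    (hz : IsCoprime x z) (hv : IsCoprime x v) : ∃ k m : F[X], v + k * x ∣ m ^ 2 - z := by
  obtain ⟨u, w, k, hc, h⟩ := exists_isCoprime_sq_sub_mul_sq_eq h2 hz hv
  have hcw : IsCoprime (v + k * x) w := by
    rw [← h, show u ^ 2 - z * w ^ 2 = u ^ 2 + w * (-z * w) by ring]
    exact (hc.pow_left (m := 2)).add_mul_left_left _
  obtain ⟨i, j, hij⟩ := hcw
  refine ⟨k, u * j, j ^ 2 - z * i * (1 + j * w), ?_⟩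
  linear_combination j ^ 2 * h + z * (1 + j * w) * hij

end QuadraticForm

section FirstRow

variable {R : Type*} [CommRing R]

theorem row_mul_m₁₂ {M : Matrix (Fin 2) (Fin 2) R} {x y : R} (hM : M 0 = ![x, y]) (t : R) :
    (M * m₁₂ t) 0 = ![x, y + x * t] := by
  ext j
  fin_cases j <;> simp [m₁₂, Matrix.mul_apply, Fin.sum_univ_two, hM, add_comm]

theorem row_mul_m₂₁ {M : Matrix (Fin 2) (Fin 2) R} {x y : R} (hM : M 0 = ![x, y]) (t : R) :
    (M * m₂₁ t) 0 = ![x + y * t, y] := by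
  ext j
  fin_cases j <;> simp [m₂₁, Matrix.mul_apply, Fin.sum_univ_two, hM]

/-- An element of `M_Λ` takes the row `(x, e²w)` to `(x', e²c)`, where `x x' + w c e² = 1` and
`x, x'` are congruent modulo `e` to the same square root of one. -/
theorem exists_mem_MLambda_row_mul {s x x' w c e a d : R} (hs : s * s = 1)
    (hx : s * x = 1 + d * e) (hx' : s * x' = 1 + a * e) (h : x * x' + w * c * e ^ 2 = 1) :
    ∃ β ∈ MLambda R, ∀ M : Matrix (Fin 2) (Fin 2) R,
      M 0 = ![x, e ^ 2 * w] → (M * β) 0 = ![x', e ^ 2 * c] := by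
  refine ⟨_, ⟨a, -(s * w), s * c, d, e, ?_, rfl⟩, fun M hM => ?_⟩
  · rw [Matrix.det_fin_two_of, ← hx, ← hx']
    linear_combination (x * x' + w * c * e ^ 2) * hs + h
  · rw [← hx, ← hx']
    ext j
    fin_cases j
    · simp [Matrix.mul_apply, Fin.sum_univ_two, hM]
      linear_combination (s * s * x') * h + x' * hs
    · simp [Matrix.mul_apply, Fin.sum_univ_two, hM]
      linear_combination (s * s * e ^ 2 * c) * h + e ^ 2 * c * hs

/-- An element of `M_Λᵀ` takes the row `(x, y)` to `(x', w)`, where `x x' + y w e² = 1` and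
`x, x'` are congruent modulo `e` to the same square root of one. -/
theorem exists_mem_MLambdaT_row_mul {s x x' y w e a d : R} (hs : s * s = 1)
    (hx : s * x = 1 + d * e) (hx' : s * x' = 1 + a * e) (h : x * x' + y * w * e ^ 2 = 1) :
    ∃ γ ∈ MLambdaT R, ∀ M : Matrix (Fin 2) (Fin 2) R,
      M 0 = ![x, y] → (M * γ) 0 = ![x', w] := by
  refine ⟨_, ⟨_, ⟨a, -(s * y), s * w, d, e, ?_, rfl⟩, rfl⟩, fun M hM => ?_⟩
  · rw [Matrix.det_fin_two_of, ← hx, ← hx']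
    linear_combination (x * x' + y * w * e ^ 2) * hs + h
  · rw [← hx, ← hx']
    ext j
    fin_cases j
    · simp [Matrix.mul_apply, Fin.sum_univ_two, hM]
      linear_combination (s * s * x') * h + x' * hs
    · simp [Matrix.mul_apply, Fin.sum_univ_two, hM]
      linear_combination (s * s * w) * h + w * hs

/-- Powers of a matrix `α` of determinant one have the form `f α + g`; the upper left entry is
multiplicative modulo the upper right entry of `α`. -/
theorem Matrix.exists_pow_eq_linear {a b c d : R}
    (hdet : (!![a, b; c, d] : Matrix (Fin 2) (Fin 2) R).det = 1) (r : ℕ) :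
    ∃ f g : R, !![a, b; c, d] ^ r = !![f * a + g, f * b; f * c, f * d + g] ∧
      b ∣ f * a + g - a ^ r := by
  rw [Matrix.det_fin_two_of] at hdet
  induction r with
  | zero => exact ⟨0, 1, by simp [Matrix.one_fin_two], by simp⟩
  | succ r ih =>
    obtain ⟨f, g, h, k, hk⟩ := ih
    refine ⟨f * (a + d) + g, -f, ?_, a * k + f * c, ?_⟩
    · rw [pow_succ, h]
      ext i j
      fin_cases i <;> fin_cases j <;> simp
      · linear_combination -f * hdet
      · ring
      · ring
      · linear_combination -f * hdet
    · linear_combination a * hk + f * hdet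

end FirstRow

/-- The row `(x, f₁ f₂ y)` with `x ≡ 1` modulo `f₁` and `x ≡ -1` modulo `f₂` is taken to
`(x - y s, y)`: the first half of the word removes `f₁`, the second removes `f₂`. -/
theorem exists_row_mul_eq {F : Type*} [Field F] [Finite F] (h2 : (2 : F) ≠ 0)
    {x y f₁ f₂ z₁ z₂ s : F[X]} (h₁ : x = 1 + f₁ * z₁) (h₂ : x = -1 + f₂ * z₂)
    (hxy : IsCoprime x (f₁ * f₂ * y)) :
    ∃ t : Fin 10 → F[X], ∃ β ∈ MLambda F[X], ∃ γ ∈ MLambdaT F[X],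
      ∀ M : Matrix (Fin 2) (Fin 2) F[X], M 0 = ![x, f₁ * f₂ * y] →
        (M * m₁₂ (t 0) * m₂₁ (t 1) * m₁₂ (t 2) * β * m₁₂ (t 3) * m₂₁ (t 4) *
          m₁₂ (t 5) * m₂₁ (t 6) * γ * m₂₁ (t 7) * m₁₂ (t 8) * m₂₁ (t 9)) 0 =
            ![x - y * s, y] := by
  have hz₁ : IsCoprime x (-z₁) := ⟨1, f₁, by linear_combination h₁⟩
  have hz₂ : IsCoprime x z₂ := ⟨-1, f₂, by linear_combination -h₂⟩
  have hxy₁ : IsCoprime x (f₂ * y) := (mul_assoc f₁ f₂ y ▸ hxy).of_mul_right_right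
  obtain ⟨k₁, m₁, n₁, hn₁⟩ := Polynomial.exists_dvd_sq_sub h2 hz₁ hxy₁
  obtain ⟨k₂, m₂, n₂, hn₂⟩ := Polynomial.exists_dvd_sq_sub h2 hz₂ hxy.of_mul_right_right
  obtain ⟨b₁, hb₁⟩ : ∃ b₁, b₁ = f₂ * y + k₁ * x := ⟨_, rfl⟩
  obtain ⟨b₂, hb₂⟩ : ∃ b₂, b₂ = y + k₂ * x := ⟨_, rfl⟩
  rw [← hb₁] at hn₁
  rw [← hb₂] at hn₂
  obtain ⟨x₁, hx₁⟩ : ∃ x₁, x₁ = 1 - f₁ * m₁ ^ 2 := ⟨_, rfl⟩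
  obtain ⟨x₂, hx₂⟩ : ∃ x₂, x₂ = -1 + f₂ * m₂ ^ 2 := ⟨_, rfl⟩
  have hxx₁ : x₁ = x + f₁ * b₁ * -n₁ := by linear_combination hx₁ - h₁ - f₁ * hn₁
  have hxx₂ : x₂ = x + f₂ * b₂ * n₂ := by linear_combination hx₂ - h₂ + f₂ * hn₂
  obtain ⟨x', c, hc⟩ : ∃ x' c, x₁ * x' + b₁ * c * (f₁ * m₁) ^ 2 = 1 := by
    have hcb : IsCoprime x₁ b₁ := by
      rw [hxx₁, show x + f₁ * b₁ * -n₁ = x + b₁ * (-f₁ * n₁) by ring]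
      refine IsCoprime.add_mul_left_left ?_ _
      rw [hb₁]
      exact hxy₁.add_mul_right_right k₁
    have hce : IsCoprime x₁ (f₁ * m₁) := ⟨1, m₁, by linear_combination hx₁⟩
    obtain ⟨i, j, hij⟩ := hcb.mul_right (hce.pow_right (n := 2))
    exact ⟨i, j, by linear_combination hij⟩
  obtain ⟨β, hβ, Hβ⟩ := exists_mem_MLambda_row_mul (s := 1) (x := x₁) (x' := x') (w := b₁) (c := c)
    (e := f₁ * m₁) (d := -m₁) (a := m₁ * x' - b₁ * c * (f₁ * m₁)) (one_mul 1)
    (by linear_combination hx₁) (by linear_combination hc - x' * hx₁) hc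
  obtain ⟨y₁, hy₁⟩ : ∃ y₁, y₁ = (f₁ * m₁) ^ 2 * c + x' * (-f₁ * n₁) := ⟨_, rfl⟩
  obtain ⟨u, hu⟩ : ∃ u, u = x' + y₁ * (k₁ - f₂ * k₂) := ⟨_, rfl⟩
  obtain ⟨y₂, hy₂⟩ : ∃ y₂, y₂ = y₁ + u * -n₂ := ⟨_, rfl⟩
  obtain ⟨u', hu'⟩ : ∃ u', u' = u + y₂ * (-f₂ * b₂) := ⟨_, rfl⟩
  have hdet : u' * x₂ + y₂ * b₂ * (f₂ * m₂) ^ 2 = 1 := by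
    have e₁ : x' * x + y₁ * b₁ = 1 := by
      linear_combination hc + b₁ * hy₁ - x' * hxx₁
    have e₂ : u * x + y₁ * (f₂ * b₂) = 1 := by
      linear_combination e₁ + x * hu - y₁ * hb₁ + y₁ * f₂ * hb₂
    have e₃ : u * x₂ + y₂ * (f₂ * b₂) = 1 := by
      linear_combination e₂ + u * hxx₂ + f₂ * b₂ * hy₂
    linear_combination e₃ + x₂ * hu' - y₂ * f₂ * b₂ * hx₂
  obtain ⟨γ, hγ, Hγ⟩ := exists_mem_MLambdaT_row_mul (s := -1) (x := u') (x' := x₂) (y := y₂)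
    (w := b₂) (e := f₂ * m₂) (a := -m₂) (d := -(y₂ * (f₂ * m₂) * b₂) - u' * m₂) (by ring)
    (by linear_combination hdet - u' * hx₂) (by linear_combination -hx₂) hdet
  refine ⟨![f₁ * k₁, -n₁, -f₁ * b₁, -f₁ * n₁, k₁ - f₂ * k₂, -n₂, -f₂ * b₂, -f₂ * n₂, -k₂, -s],
    β, hβ, γ, hγ, fun M hM => ?_⟩
  have H := row_mul_m₁₂ hM (f₁ * k₁)
  rw [show f₁ * f₂ * y + x * (f₁ * k₁) = f₁ * b₁ by rw [hb₁]; ring] at H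
  have H := row_mul_m₂₁ H (-n₁)
  rw [← hxx₁] at H
  have H := row_mul_m₁₂ H (-f₁ * b₁)
  rw [show f₁ * b₁ + x₁ * (-f₁ * b₁) = (f₁ * m₁) ^ 2 * b₁ by rw [hx₁]; ring] at H
  have H := row_mul_m₁₂ (Hβ _ H) (-f₁ * n₁)
  rw [← hy₁] at H
  have H := row_mul_m₂₁ H (k₁ - f₂ * k₂)
  rw [← hu] at H
  have H := row_mul_m₁₂ H (-n₂)
  rw [← hy₂] at H
  have H := row_mul_m₂₁ H (-f₂ * b₂)
  rw [← hu'] at H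
  have H := row_mul_m₂₁ (Hγ _ H) (-f₂ * n₂)
  rw [show x₂ + b₂ * (-f₂ * n₂) = x by rw [hxx₂]; ring] at H
  have H := row_mul_m₁₂ H (-k₂)
  rw [show b₂ + x * -k₂ = y by rw [hb₂]; ring] at H
  have H := row_mul_m₂₁ H (-s)
  rw [mul_neg, ← sub_eq_add_neg] at H
  exact H

/-- Lemma 3.2: with `A = 𝔽_q[T]` (`q` a power of an odd prime), let
`α = [[a, b], [c, d]] ∈ SL₂(A)` and let `r ≥ 1`.  Then there exist
`t⁽¹⁾, …, t⁽¹⁰⁾ ∈ A`, a nonzero `ε ∈ 𝔽_q`, `β ∈ M_Λ`, and `γ ∈ M_Λᵀ` such that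
`α^r · t⁽¹⁾_{12} · t⁽²⁾_{21} · t⁽³⁾_{12} · β · t⁽⁴⁾_{12} · t⁽⁵⁾_{21} · t⁽⁶⁾_{12} ·
t⁽⁷⁾_{21} · γ · t⁽⁸⁾_{21} · t⁽⁹⁾_{12} · t⁽¹⁰⁾_{21}` has first row `(a^r, εb)`. -/
theorem lemma_power_first_row
    (F : Type) [Field F] [Fintype F] (hq : Odd (Fintype.card F))
    (a b c d : Polynomial F)
    (hdet : (!![a, b; c, d] : Matrix (Fin 2) (Fin 2) (Polynomial F)).det = 1)
    (r : ℕ) (hr : 1 ≤ r) :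
    ∃ (t : Fin 10 → Polynomial F) (ε : F), ε ≠ 0 ∧
      ∃ β ∈ MLambda (Polynomial F), ∃ γ ∈ MLambdaT (Polynomial F),
        ((!![a, b; c, d] : Matrix (Fin 2) (Fin 2) (Polynomial F)) ^ r *
            m₁₂ (t 0) * m₂₁ (t 1) * m₁₂ (t 2) * β * m₁₂ (t 3) * m₂₁ (t 4) *
            m₁₂ (t 5) * m₂₁ (t 6) * γ * m₂₁ (t 7) * m₁₂ (t 8) * m₂₁ (t 9)) 0 0 =
          a ^ r ∧
        ((!![a, b; c, d] : Matrix (Fin 2) (Fin 2) (Polynomial F)) ^ r *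
            m₁₂ (t 0) * m₂₁ (t 1) * m₁₂ (t 2) * β * m₁₂ (t 3) * m₂₁ (t 4) *
            m₁₂ (t 5) * m₂₁ (t 6) * γ * m₂₁ (t 7) * m₁₂ (t 8) * m₂₁ (t 9)) 0 1 =
          C ε * b := by
  have h2 : (2 : F) ≠ 0 := by
    refine Ring.two_ne_zero fun h => ?_
    have := FiniteField.even_card_of_char_two h
    grind
  obtain ⟨f, g, hα, s, hs⟩ := Matrix.exists_pow_eq_linear hdet r
  obtain ⟨f₁, f₂, ⟨j₁, h₁⟩, ⟨j₂, h₂⟩, rfl⟩ :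
      ∃ f₁ f₂, f₁ ∣ 1 - g ∧ f₂ ∣ 1 + g ∧ f = f₁ * f₂ := by
    apply exists_dvd_and_dvd_of_dvd_mul
    have h := congrArg Matrix.det hα
    rw [Matrix.det_pow, hdet, one_pow, Matrix.det_fin_two_of] at h
    exact ⟨f * (a * d - b * c) + g * (a + d), by linear_combination h⟩
  have hrow : IsCoprime (f₁ * f₂ * a + g) (f₁ * f₂ * b) := by
    have h := congrArg Matrix.det hα
    rw [Matrix.det_pow, hdet, one_pow, Matrix.det_fin_two_of] at h
    exact ⟨f₁ * f₂ * d + g, -(f₁ * f₂ * c), by linear_combination -h⟩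
  obtain ⟨t, β, hβ, γ, hγ, H⟩ := exists_row_mul_eq h2 (y := b) (s := s)
    (show f₁ * f₂ * a + g = 1 + f₁ * (f₂ * a - j₁) by linear_combination -h₁)
    (show f₁ * f₂ * a + g = -1 + f₂ * (f₁ * a + j₂) by linear_combination h₂) hrow
  refine ⟨t, 1, one_ne_zero, β, hβ, γ, hγ, ?_⟩
  have H := H _ (show ((!![a, b; c, d] : Matrix (Fin 2) (Fin 2) F[X]) ^ r) 0 =
    ![f₁ * f₂ * a + g, f₁ * f₂ * b] by rw [hα]; rfl)
  simp only [H, Matrix.cons_val_zero, Matrix.cons_val_one, map_one, one_mul, and_true]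
  linear_combination hs
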